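/- Let f, g^{(1)},…,g^{(n)} : ℝ² → ℝ be smooth functions of (X,T) with f nowhere zero, satisfying: (i) f_{XT} g^{(i)} − f_X g^{(i)}_T − f_T g^{(i)}_X + f g^{(i)}_{XT} = f·g^{(i)} for each i = 1,…,n; and (ii) f_{TT} f − (f_T)² = (1/4) Σ_{1≤j<k≤n} c_{jk} g^{(j)} g^{(k)} (i.e. D_T² f·f = (1/2) Σ_{j<k} c_{jk} g^{(j)} g^{(k)}). Then u^{(i)} := g^{(i)}/f and ρ := 1 − 2·(f·f_{XT} − f_X·f_T)/f² satisfy ∂_X∂_T u^{(i)} = u^{(i)}·ρ and ∂_T ρ + (1/2) ∂_X( Σ_{1≤j<k≤n} c_{jk} u^{(j)} u^{(k)} ) = 0. -/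

import Mathlib

/-- Partial derivative with respect to the first variable. -/
noncomputable def pdx (f : ℝ → ℝ → ℝ) (x t : ℝ) : ℝ := deriv (fun y => f y t) x

/-- Partial derivative with respect to the second variable. -/
noncomputable def pdt (f : ℝ → ℝ → ℝ) (x t : ℝ) : ℝ := deriv (fun s => f x s) t

open scoped ContDiff

section PartialDerivatives

variable {h k : ℝ → ℝ → ℝ}

theorem hasDerivAt_slice_fst (hh : ContDiff ℝ ∞ (fun p : ℝ × ℝ => h p.1 p.2)) (x t : ℝ) :
    HasDerivAt (fun y => h y t) (fderiv ℝ (fun p : ℝ × ℝ => h p.1 p.2) (x, t) (1, 0)) x :=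
  (hh.differentiable (by simp) (x, t)).hasFDerivAt.comp_hasDerivAt (f := fun y => (y, t)) x
    ((hasDerivAt_id x).prodMk (hasDerivAt_const x t))

theorem hasDerivAt_slice_snd (hh : ContDiff ℝ ∞ (fun p : ℝ × ℝ => h p.1 p.2)) (x t : ℝ) :
    HasDerivAt (fun s => h x s) (fderiv ℝ (fun p : ℝ × ℝ => h p.1 p.2) (x, t) (0, 1)) t :=
  (hh.differentiable (by simp) (x, t)).hasFDerivAt.comp_hasDerivAt (f := fun s => (x, s)) t
    ((hasDerivAt_const t x).prodMk (hasDerivAt_id t))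

theorem pdx_eq_fderiv (hh : ContDiff ℝ ∞ (fun p : ℝ × ℝ => h p.1 p.2)) (x t : ℝ) :
    pdx h x t = fderiv ℝ (fun p : ℝ × ℝ => h p.1 p.2) (x, t) (1, 0) :=
  (hasDerivAt_slice_fst hh x t).deriv

theorem pdt_eq_fderiv (hh : ContDiff ℝ ∞ (fun p : ℝ × ℝ => h p.1 p.2)) (x t : ℝ) :
    pdt h x t = fderiv ℝ (fun p : ℝ × ℝ => h p.1 p.2) (x, t) (0, 1) :=
  (hasDerivAt_slice_snd hh x t).deriv

theorem hasDerivAt_pdx (hh : ContDiff ℝ ∞ (fun p : ℝ × ℝ => h p.1 p.2)) (x t : ℝ) :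
    HasDerivAt (fun y => h y t) (pdx h x t) x :=
  (hasDerivAt_slice_fst hh x t).differentiableAt.hasDerivAt

theorem hasDerivAt_pdt (hh : ContDiff ℝ ∞ (fun p : ℝ × ℝ => h p.1 p.2)) (x t : ℝ) :
    HasDerivAt (fun s => h x s) (pdt h x t) t :=
  (hasDerivAt_slice_snd hh x t).differentiableAt.hasDerivAt

theorem contDiff_pdx (hh : ContDiff ℝ ∞ (fun p : ℝ × ℝ => h p.1 p.2)) :
    ContDiff ℝ ∞ (fun p : ℝ × ℝ => pdx h p.1 p.2) := by
  simp only [pdx_eq_fderiv hh]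
  exact (hh.fderiv_right (m := ∞) le_rfl).clm_apply contDiff_const

theorem contDiff_pdt (hh : ContDiff ℝ ∞ (fun p : ℝ × ℝ => h p.1 p.2)) :
    ContDiff ℝ ∞ (fun p : ℝ × ℝ => pdt h p.1 p.2) := by
  simp only [pdt_eq_fderiv hh]
  exact (hh.fderiv_right (m := ∞) le_rfl).clm_apply contDiff_const

theorem pdt_pdx_comm (hh : ContDiff ℝ ∞ (fun p : ℝ × ℝ => h p.1 p.2)) (x t : ℝ) :
    pdt (pdx h) x t = pdx (pdt h) x t := by
  have hd : DifferentiableAt ℝ (fderiv ℝ (fun p : ℝ × ℝ => h p.1 p.2)) (x, t) :=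
    (hh.fderiv_right (m := ∞) le_rfl).differentiable (by simp) _
  have hsymm : IsSymmSndFDerivAt ℝ (fun p : ℝ × ℝ => h p.1 p.2) (x, t) :=
    hh.contDiffAt.isSymmSndFDerivAt (by
      rw [minSmoothness_of_isRCLikeNormedField]
      exact WithTop.coe_le_coe.2 le_top)
  rw [pdt_eq_fderiv (contDiff_pdx hh), pdx_eq_fderiv (contDiff_pdt hh)]
  simp only [pdx_eq_fderiv hh, pdt_eq_fderiv hh]
  rw [fderiv_clm_apply hd (differentiableAt_const _),
    fderiv_clm_apply hd (differentiableAt_const _)]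
  simpa using hsymm.eq (0, 1) (1, 0)

theorem pdx_div (hh : ContDiff ℝ ∞ (fun p : ℝ × ℝ => h p.1 p.2))
    (hk : ContDiff ℝ ∞ (fun p : ℝ × ℝ => k p.1 p.2)) (hk0 : ∀ x t, k x t ≠ 0) (x t : ℝ) :
    pdx (fun x t => h x t / k x t) x t
      = (pdx h x t * k x t - h x t * pdx k x t) / k x t ^ 2 :=
  ((hasDerivAt_pdx hh x t).fun_div (hasDerivAt_pdx hk x t) (hk0 x t)).deriv

theorem pdt_div (hh : ContDiff ℝ ∞ (fun p : ℝ × ℝ => h p.1 p.2))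
    (hk : ContDiff ℝ ∞ (fun p : ℝ × ℝ => k p.1 p.2)) (hk0 : ∀ x t, k x t ≠ 0) (x t : ℝ) :
    pdt (fun x t => h x t / k x t) x t
      = (pdt h x t * k x t - h x t * pdt k x t) / k x t ^ 2 :=
  ((hasDerivAt_pdt hh x t).fun_div (hasDerivAt_pdt hk x t) (hk0 x t)).deriv

end PartialDerivatives

/-- the bilinear equations D_X D_T f·g^{(i)} = f g^{(i)},
    D_T² f·f = (1/2) Σ_{j<k} c_{jk} g^{(j)} g^{(k)} yield, via the dependent variable
    transformation u^{(i)} = g^{(i)}/f, ρ = 1 − 2(log f)_{XT}, solutions of the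
    multi-component coupled integrable dispersionless equations (MCSP version). -/
theorem mcsp_bilinear_to_dispersionless (n : ℕ) (hn : 1 ≤ n)
    (c : Fin n → Fin n → ℝ)
    (f : ℝ → ℝ → ℝ) (g : Fin n → ℝ → ℝ → ℝ)
    (hf : ContDiff ℝ (⊤ : ℕ∞) (fun p : ℝ × ℝ => f p.1 p.2))
    (hg : ∀ i, ContDiff ℝ (⊤ : ℕ∞) (fun p : ℝ × ℝ => g i p.1 p.2))
    (hfne : ∀ X T, f X T ≠ 0)
    (hbil1 : ∀ i X T,
      pdx (pdt f) X T * g i X T - pdx f X T * pdt (g i) X T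
        - pdt f X T * pdx (g i) X T + f X T * pdx (pdt (g i)) X T
        = f X T * g i X T)
    (hbil2 : ∀ X T,
      pdt (pdt f) X T * f X T - (pdt f X T)^2
        = (1/4) * ∑ j : Fin n, ∑ k : Fin n,
            if j < k then c j k * g j X T * g k X T else 0)
    (u : Fin n → ℝ → ℝ → ℝ)
    (hu : ∀ i X T, u i X T = g i X T / f X T)
    (ρ : ℝ → ℝ → ℝ)
    (hρ : ∀ X T,
      ρ X T = 1 - 2 * (f X T * pdx (pdt f) X T - pdx f X T * pdt f X T) / (f X T)^2) :
    (∀ i X T, pdx (pdt (u i)) X T = u i X T * ρ X T) ∧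
    (∀ X T,
      pdt ρ X T
        + (1/2) * pdx (fun X' T' => ∑ j : Fin n, ∑ k : Fin n,
            if j < k then c j k * u j X' T' * u k X' T' else 0) X T = 0) := by
  have hu' : ∀ i, u i = fun X T => g i X T / f X T := fun i => funext₂ (hu i)
  refine ⟨fun i X T => ?_, fun X T => ?_⟩
  · have hpdt : pdt (u i)
        = fun X T => (pdt (g i) X T * f X T - g i X T * pdt f X T) / f X T ^ 2 := by
      rw [hu' i]
      exact funext₂ (pdt_div (hg i) hf hfne)
    have hf0 := hfne X T
    have hfx := hasDerivAt_pdx hf X T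
    have hderiv := (((hasDerivAt_pdx (contDiff_pdt (hg i)) X T).fun_mul hfx).fun_sub
      ((hasDerivAt_pdx (hg i) X T).fun_mul (hasDerivAt_pdx (contDiff_pdt hf) X T))).fun_div
      (hfx.fun_pow 2) (pow_ne_zero 2 hf0)
    rw [hpdt, pdx, hderiv.deriv, hu, hρ]
    field_simp
    linear_combination f X T ^ 2 * hbil1 i X T
  · have hw : ContDiff ℝ ∞ (fun p : ℝ × ℝ => pdt f p.1 p.2 / f p.1 p.2) :=
      (contDiff_pdt hf).div hf fun p => hfne p.1 p.2
    have hρ' : ρ = fun X T => 1 - 2 * pdx (fun X T => pdt f X T / f X T) X T := by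
      funext X T
      rw [hρ, pdx_div (contDiff_pdt hf) hf hfne]
      ring
    have hsum : (fun X' T' => ∑ j : Fin n, ∑ k : Fin n,
        if j < k then c j k * u j X' T' * u k X' T' else 0)
        = fun X T => 4 * pdt (fun X T => pdt f X T / f X T) X T := by
      funext X T
      have hf0 := hfne X T
      have hscale : (∑ j : Fin n, ∑ k : Fin n,
          if j < k then c j k * u j X T * u k X T else 0)
          = (∑ j : Fin n, ∑ k : Fin n,
            if j < k then c j k * g j X T * g k X T else 0) / f X T ^ 2 := by
        simp only [Finset.sum_div, hu]
        refine Finset.sum_congr rfl fun j _ => Finset.sum_congr rfl fun k _ => ?_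
        split_ifs
        · field_simp
        · simp
      rw [hscale, pdt_div (contDiff_pdt hf) hf hfne]
      field_simp
      linear_combination (-4) * hbil2 X T
    have hpdtρ : pdt ρ X T = -(2 * pdt (pdx (fun X T => pdt f X T / f X T)) X T) := by
      rw [hρ']
      exact (((hasDerivAt_pdt (contDiff_pdx hw) X T).const_mul 2).const_sub 1).deriv
    have hpdx : pdx (fun X T => 4 * pdt (fun X T => pdt f X T / f X T) X T) X T
        = 4 * pdx (pdt (fun X T => pdt f X T / f X T)) X T :=
      ((hasDerivAt_pdx (contDiff_pdt (h := fun X T => pdt f X T / f X T) hw) X T).const_mul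
        4).deriv
    rw [hsum, hpdtρ, hpdx, pdt_pdx_comm hw]
    ring
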